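/- arXiv:1205.2051 — 2 statements merged into one kernel-verified Lean document; each statement's English description precedes it below -/
import Mathlib

section
/- The constant-time problem classes form a strict linear order: SB(1) ⊊ MB(1) = VB(1) ⊊ SV(1) = MV(1) = VV(1) ⊊ VVc(1). -/
namespace Weak

/-- The degree of a vertex. -/
noncomputable def deg {n : ℕ} (G : SimpleGraph (Fin n)) (v : Fin n) : ℕ :=
  Nat.card {u : Fin n // G.Adj v u}

/-- A port of a graph: a pair (v, i) with i ∈ [deg v]. -/
abbrev Port {n : ℕ} (G : SimpleGraph (Fin n)) : Type := Σ v : Fin n, Fin (deg G v)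

/-- A port numbering: a bijection on ports with A(p) = A(G). -/
structure PortNumbering {n : ℕ} (G : SimpleGraph (Fin n)) where
  p : Port G ≃ Port G
  adj : ∀ u v : Fin n, (∃ i : Fin (deg G u), (p ⟨u, i⟩).1 = v) ↔ G.Adj u v

/-- A consistent port numbering is an involution. -/
def PortNumbering.Consistent {n : ℕ} {G : SimpleGraph (Fin n)} (pn : PortNumbering G) : Prop :=
  ∀ q : Port G, pn.p (pn.p q) = q

/-- A distributed state machine for F(Δ), with stopping states Y. -/
structure DSM (Y : Type) (Δ : ℕ) where
  Z : Type
  z₀ : Fin (Δ + 1) → Y ⊕ Z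
  M : Type
  m₀ : M
  μ : Z → Fin Δ → M
  δ : Z → (Fin Δ → M) → Y ⊕ Z

namespace DSM

variable {Y : Type} {Δ : ℕ}

/-- μ extended to stopping states: a stopped node sends the dummy message. -/
def μ' (A : DSM Y Δ) : Y ⊕ A.Z → Fin Δ → A.M
  | Sum.inl _ => fun _ => A.m₀
  | Sum.inr z => A.μ z

/-- δ extended to stopping states: a stopped node no longer changes state. -/
def δ' (A : DSM Y Δ) : Y ⊕ A.Z → (Fin Δ → A.M) → Y ⊕ A.Z
  | Sum.inl y, _ => Sum.inl y
  | Sum.inr z, m => A.δ z m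

/-- Machines whose transition depends only on the multiset of received messages. -/
def InMultiset (A : DSM Y Δ) : Prop :=
  ∀ (z : A.Z) (a b : Fin Δ → A.M),
    (List.ofFn a : Multiset A.M) = (List.ofFn b : Multiset A.M) → A.δ z a = A.δ z b

/-- Machines whose transition depends only on the set of received messages. -/
def InSet (A : DSM Y Δ) : Prop :=
  ∀ (z : A.Z) (a b : Fin Δ → A.M), Set.range a = Set.range b → A.δ z a = A.δ z b

/-- Machines that send the same message to all ports. -/
def InBroadcast (A : DSM Y Δ) : Prop :=
  ∀ (z : A.Z) (i j : Fin Δ), A.μ z i = A.μ z j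

end DSM

/-- The execution of a machine in (G, p): the state of node u at time t. -/
noncomputable def exec {Y : Type} {Δ n : ℕ} (A : DSM Y Δ) (G : SimpleGraph (Fin n))
    (hG : ∀ v, deg G v ≤ Δ) (pn : PortNumbering G) : ℕ → Fin n → Y ⊕ A.Z
  | 0, u => A.z₀ ⟨deg G u, Nat.lt_succ_of_le (hG u)⟩
  | t + 1, u =>
      A.δ' (exec A G hG pn t u) fun k =>
        if h : (k : ℕ) < deg G u then
          A.μ' (exec A G hG pn t (pn.p.symm ⟨u, ⟨(k : ℕ), h⟩⟩).1)
            ⟨((pn.p.symm ⟨u, ⟨(k : ℕ), h⟩⟩).2 : ℕ),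
              lt_of_lt_of_le (pn.p.symm ⟨u, ⟨(k : ℕ), h⟩⟩).2.isLt (hG _)⟩
        else A.m₀

/-- A graph problem: for each graph, a set of admissible outputs. -/
abbrev GraphProblem (Y : Type) : Type :=
  ∀ n : ℕ, SimpleGraph (Fin n) → Set ((Fin n) → Y)

/-- A sequence of machines solves a problem in time T. -/
def SolvesInTime {Y : Type} (A : ∀ Δ : ℕ, DSM Y Δ) (P : GraphProblem Y)
    (T : ℕ → ℕ → ℕ) : Prop :=
  ∀ (Δ n : ℕ) (G : SimpleGraph (Fin n)) (hG : ∀ v, deg G v ≤ Δ) (pn : PortNumbering G),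
    ∃ S ∈ P n G, ∀ u, exec (A Δ) G hG pn (T Δ n) u = Sum.inl (S u)

/-- A sequence of machines solves a problem in time T assuming consistency. -/
def SolvesInTimeConsistent {Y : Type} (A : ∀ Δ : ℕ, DSM Y Δ) (P : GraphProblem Y)
    (T : ℕ → ℕ → ℕ) : Prop :=
  ∀ (Δ n : ℕ) (G : SimpleGraph (Fin n)) (hG : ∀ v, deg G v ≤ Δ) (pn : PortNumbering G),
    pn.Consistent →
    ∃ S ∈ P n G, ∀ u, exec (A Δ) G hG pn (T Δ n) u = Sum.inl (S u)

/-- Problem class VV. -/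
def VV {Y : Type} (P : GraphProblem Y) : Prop :=
  ∃ A : ∀ Δ : ℕ, DSM Y Δ, ∃ T, SolvesInTime A P T

/-- Problem class MV. -/
def MV {Y : Type} (P : GraphProblem Y) : Prop :=
  ∃ A : ∀ Δ : ℕ, DSM Y Δ, (∀ Δ, (A Δ).InMultiset) ∧ ∃ T, SolvesInTime A P T

/-- Problem class SV. -/
def SV {Y : Type} (P : GraphProblem Y) : Prop :=
  ∃ A : ∀ Δ : ℕ, DSM Y Δ, (∀ Δ, (A Δ).InSet) ∧ ∃ T, SolvesInTime A P T

/-- Problem class VB. -/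
def VB {Y : Type} (P : GraphProblem Y) : Prop :=
  ∃ A : ∀ Δ : ℕ, DSM Y Δ, (∀ Δ, (A Δ).InBroadcast) ∧ ∃ T, SolvesInTime A P T

/-- Problem class MB. -/
def MB {Y : Type} (P : GraphProblem Y) : Prop :=
  ∃ A : ∀ Δ : ℕ, DSM Y Δ, (∀ Δ, (A Δ).InMultiset ∧ (A Δ).InBroadcast) ∧ ∃ T, SolvesInTime A P T

/-- Problem class SB. -/
def SB {Y : Type} (P : GraphProblem Y) : Prop :=
  ∃ A : ∀ Δ : ℕ, DSM Y Δ, (∀ Δ, (A Δ).InSet ∧ (A Δ).InBroadcast) ∧ ∃ T, SolvesInTime A P T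

/-- Problem class VVc. -/
def VVc {Y : Type} (P : GraphProblem Y) : Prop :=
  ∃ A : ∀ Δ : ℕ, DSM Y Δ, ∃ T, SolvesInTimeConsistent A P T

/-- Constant-time problem class VV(1). -/
def VV1 {Y : Type} (P : GraphProblem Y) : Prop :=
  ∃ A : ∀ Δ : ℕ, DSM Y Δ, ∃ T' : ℕ → ℕ, SolvesInTime A P fun Δ _ => T' Δ

/-- Constant-time problem class MV(1). -/
def MV1 {Y : Type} (P : GraphProblem Y) : Prop :=
  ∃ A : ∀ Δ : ℕ, DSM Y Δ, (∀ Δ, (A Δ).InMultiset) ∧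
    ∃ T' : ℕ → ℕ, SolvesInTime A P fun Δ _ => T' Δ

/-- Constant-time problem class SV(1). -/
def SV1 {Y : Type} (P : GraphProblem Y) : Prop :=
  ∃ A : ∀ Δ : ℕ, DSM Y Δ, (∀ Δ, (A Δ).InSet) ∧
    ∃ T' : ℕ → ℕ, SolvesInTime A P fun Δ _ => T' Δ

/-- Constant-time problem class VB(1). -/
def VB1 {Y : Type} (P : GraphProblem Y) : Prop :=
  ∃ A : ∀ Δ : ℕ, DSM Y Δ, (∀ Δ, (A Δ).InBroadcast) ∧
    ∃ T' : ℕ → ℕ, SolvesInTime A P fun Δ _ => T' Δ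

/-- Constant-time problem class MB(1). -/
def MB1 {Y : Type} (P : GraphProblem Y) : Prop :=
  ∃ A : ∀ Δ : ℕ, DSM Y Δ, (∀ Δ, (A Δ).InMultiset ∧ (A Δ).InBroadcast) ∧
    ∃ T' : ℕ → ℕ, SolvesInTime A P fun Δ _ => T' Δ

/-- Constant-time problem class SB(1). -/
def SB1 {Y : Type} (P : GraphProblem Y) : Prop :=
  ∃ A : ∀ Δ : ℕ, DSM Y Δ, (∀ Δ, (A Δ).InSet ∧ (A Δ).InBroadcast) ∧
    ∃ T' : ℕ → ℕ, SolvesInTime A P fun Δ _ => T' Δ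

/-- Constant-time problem class VVc(1). -/
def VVc1 {Y : Type} (P : GraphProblem Y) : Prop :=
  ∃ A : ∀ Δ : ℕ, DSM Y Δ, ∃ T' : ℕ → ℕ, SolvesInTimeConsistent A P fun Δ _ => T' Δ

end Weak

namespace Weak

/-! ### Incoming ports as lists -/

section Ports

variable {n : ℕ} {G : SimpleGraph (Fin n)}

open Classical in
/-- The neighbourhood of a vertex. -/
noncomputable def nbrs (G : SimpleGraph (Fin n)) (u : Fin n) : Finset (Fin n) :=
  Finset.univ.filter (G.Adj u)

lemma mem_nbrs {u v : Fin n} : v ∈ nbrs G u ↔ G.Adj u v := by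
  simp [nbrs]

lemma card_nbrs (u : Fin n) : (nbrs G u).card = deg G u := by
  classical
  rw [deg, Nat.card_eq_fintype_card, Fintype.card_subtype, nbrs]

lemma deg_eq_of_decidable (G : SimpleGraph (Fin n)) [DecidableRel G.Adj] (v : Fin n) :
    deg G v = (Finset.univ.filter (G.Adj v)).card := by
  rw [deg, Nat.card_eq_fintype_card, Fintype.card_subtype]

lemma injective_of_forall_exists_iff {u : Fin n} (f : Fin (deg G u) → Fin n)
    (hf : ∀ v, (∃ i, f i = v) ↔ G.Adj u v) : Function.Injective f := by
  classical
  have h : Finset.univ.image f = nbrs G u := by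
    ext v
    simp [mem_nbrs, hf]
  have h2 : (Finset.univ.image f).card = (Finset.univ : Finset (Fin (deg G u))).card := by
    rw [h, card_nbrs, Finset.card_univ, Fintype.card_fin]
  intro a b hab
  exact Finset.card_image_iff.mp h2 (by simp) (by simp) hab

namespace PortNumbering

variable (pn : PortNumbering G)

lemma adj_symm (u v : Fin n) :
    (∃ k : Fin (deg G u), (pn.p.symm ⟨u, k⟩).1 = v) ↔ G.Adj u v := by
  rw [G.adj_comm, ← pn.adj v u]
  constructor
  · rintro ⟨k, rfl⟩
    exact ⟨(pn.p.symm ⟨u, k⟩).2, by simp⟩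
  · rintro ⟨i, rfl⟩
    exact ⟨(pn.p ⟨v, i⟩).2, by simp⟩

lemma injective_target (u : Fin n) :
    Function.Injective fun i : Fin (deg G u) => (pn.p ⟨u, i⟩).1 :=
  injective_of_forall_exists_iff _ (pn.adj u)

lemma injective_source (u : Fin n) :
    Function.Injective fun k : Fin (deg G u) => (pn.p.symm ⟨u, k⟩).1 :=
  injective_of_forall_exists_iff _ (pn.adj_symm u)

open Classical in
/-- The port of `v` whose messages reach `u`. -/
noncomputable def outPort (v u : Fin n) : ℕ :=
  if h : ∃ i : Fin (deg G v), (pn.p ⟨v, i⟩).1 = u then (h.choose : ℕ) else 0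

lemma outPort_target (v : Fin n) (i : Fin (deg G v)) :
    pn.outPort v (pn.p ⟨v, i⟩).1 = i := by
  have h : ∃ j : Fin (deg G v), (pn.p ⟨v, j⟩).1 = (pn.p ⟨v, i⟩).1 := ⟨i, rfl⟩
  rw [outPort, dif_pos h]
  exact congrArg Fin.val (pn.injective_target v h.choose_spec)

lemma outPort_source (u : Fin n) (k : Fin (deg G u)) :
    pn.outPort (pn.p.symm ⟨u, k⟩).1 u = (pn.p.symm ⟨u, k⟩).2 := by
  have h := pn.outPort_target (pn.p.symm ⟨u, k⟩).1 (pn.p.symm ⟨u, k⟩).2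
  simpa using h

lemma outPort_injOn (v : Fin n) : Set.InjOn (pn.outPort v) (nbrs G v) := by
  intro a ha b hb hab
  obtain ⟨i, rfl⟩ := (pn.adj v a).mpr (mem_nbrs.mp ha)
  obtain ⟨j, rfl⟩ := (pn.adj v b).mpr (mem_nbrs.mp hb)
  rw [outPort_target, outPort_target] at hab
  rw [Fin.ext hab]

/-- The ports from which `u` receives messages, in the order of the ports of `u`. -/
noncomputable def inList (u : Fin n) : List (Fin n × ℕ) :=
  List.ofFn fun k : Fin (deg G u) => ((pn.p.symm ⟨u, k⟩).1, ((pn.p.symm ⟨u, k⟩).2 : ℕ))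

lemma length_inList (u : Fin n) : (pn.inList u).length = deg G u := by
  simp [inList]

lemma mem_inList {u v : Fin n} {j : ℕ} :
    (v, j) ∈ pn.inList u ↔ v ∈ nbrs G u ∧ j = pn.outPort v u := by
  rw [inList, List.mem_ofFn, mem_nbrs, ← pn.adj_symm]
  constructor
  · rintro ⟨k, hk⟩
    obtain ⟨rfl, rfl⟩ := Prod.mk.inj hk
    exact ⟨⟨k, rfl⟩, (pn.outPort_source u k).symm⟩
  · rintro ⟨⟨k, rfl⟩, rfl⟩
    exact ⟨k, by rw [pn.outPort_source u k]⟩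

lemma nodup_inList (u : Fin n) : (pn.inList u).Nodup := by
  rw [inList, List.nodup_ofFn]
  intro a b hab
  exact pn.injective_source u (Prod.mk.inj hab).1

lemma coe_inList (u : Fin n) :
    (pn.inList u : Multiset (Fin n × ℕ)) =
      (nbrs G u).val.map fun v => (v, pn.outPort v u) := by
  refine (Multiset.Nodup.ext (Multiset.coe_nodup.mpr (pn.nodup_inList u)) ?_).mpr ?_
  · exact (nbrs G u).nodup.map fun a b h => (Prod.mk.inj h).1
  · rintro ⟨v, j⟩
    rw [Multiset.mem_coe, mem_inList]
    simp only [Multiset.mem_map, Finset.mem_val, Prod.mk.injEq]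
    constructor
    · rintro ⟨h, rfl⟩
      exact ⟨v, h, rfl, rfl⟩
    · rintro ⟨w, h, rfl, rfl⟩
      exact ⟨h, rfl⟩

end PortNumbering

end Ports

/-! ### Padded message vectors -/

section Pad

variable {M : Type}

/-- The vector of length `Δ` that starts with the entries of `l`. -/
def pad (Δ : ℕ) (l : List M) : Fin Δ → Option M := fun k => l[(k : ℕ)]?

lemma ofFn_pad {Δ : ℕ} {l : List M} (h : l.length ≤ Δ) :
    List.ofFn (pad Δ l) = l.map some ++ List.replicate (Δ - l.length) none := by
  apply List.ext_getElem?
  intro i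
  rw [List.getElem?_ofFn, List.getElem?_append]
  simp only [List.length_map, List.getElem?_map, List.getElem?_replicate, pad]
  split_ifs with h1 h2 h3 h4
  · simp [h2]
  · simp; omega
  · omega
  · omega
  · omega
  · rfl

lemma reduceOption_map_some (l : List M) : (l.map some).reduceOption = l := by
  induction l with
  | nil => rfl
  | cons a l ih => simp [ih]

lemma reduceOption_ofFn_pad {Δ : ℕ} {l : List M} (h : l.length ≤ Δ) :
    (List.ofFn (pad Δ l)).reduceOption = l := by
  rw [ofFn_pad h, List.reduceOption_append, reduceOption_map_some,
    List.reduceOption_replicate_none, List.append_nil]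

lemma coe_ofFn_pad_eq {Δ : ℕ} {l₁ l₂ : List M} (h : l₁.Perm l₂) (h₁ : l₁.length ≤ Δ) :
    (List.ofFn (pad Δ l₁) : Multiset (Option M)) = List.ofFn (pad Δ l₂) := by
  rw [ofFn_pad h₁, ofFn_pad (h.length_eq ▸ h₁), h.length_eq]
  exact Multiset.coe_eq_coe.mpr ((h.map some).append_right _)

lemma mem_range_pad {Δ : ℕ} {l : List M} (h : l.length ≤ Δ) (m : M) :
    some m ∈ Set.range (pad Δ l) ↔ m ∈ l := by
  constructor
  · rintro ⟨k, hk⟩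
    exact List.mem_of_getElem? hk
  · intro hm
    obtain ⟨i, hi, rfl⟩ := List.mem_iff_getElem.mp hm
    exact ⟨⟨i, hi.trans_le h⟩, by simp [pad, hi]⟩

end Pad

/-! ### Round-based algorithms -/

/-- A synchronous algorithm in which all nodes keep running forever, and in which every port
carries a message in every round. -/
structure Algo (Y : Type) (Δ : ℕ) where
  S : Type
  M : Type
  start : ℕ → S
  msg : S → ℕ → M
  step : S → (Fin Δ → Option M) → S
  out : S → Option Y

namespace Algo

variable {Y : Type} {Δ : ℕ}

/-- Algorithms that ignore the order of the received messages. -/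
def InMultiset (B : Algo Y Δ) : Prop :=
  ∀ (s : B.S) (a b : Fin Δ → Option B.M),
    (List.ofFn a : Multiset (Option B.M)) = (List.ofFn b : Multiset (Option B.M)) →
      B.step s a = B.step s b

/-- Algorithms that ignore the order and the multiplicities of the received messages. -/
def InSet (B : Algo Y Δ) : Prop :=
  ∀ (s : B.S) (a b : Fin Δ → Option B.M), Set.range a = Set.range b → B.step s a = B.step s b

/-- Algorithms that send the same message to all ports. -/
def InBroadcast (B : Algo Y Δ) : Prop :=
  ∀ (s : B.S) (i j : ℕ), i < Δ → j < Δ → B.msg s i = B.msg s j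

/-- The list of messages received by `u` when the states are given by `x`. -/
noncomputable def received (B : Algo Y Δ) {n : ℕ} {G : SimpleGraph (Fin n)} (pn : PortNumbering G)
    (x : Fin n → B.S) (u : Fin n) : List B.M :=
  (pn.inList u).map fun q => B.msg (x q.1) q.2

/-- The states of the nodes at a given time. -/
noncomputable def run (B : Algo Y Δ) {n : ℕ} {G : SimpleGraph (Fin n)} (pn : PortNumbering G) :
    ℕ → Fin n → B.S
  | 0, u => B.start (deg G u)
  | t + 1, u => B.step (B.run pn t u) (pad Δ (B.received pn (B.run pn t) u))

lemma length_received (B : Algo Y Δ) {n : ℕ} {G : SimpleGraph (Fin n)} (pn : PortNumbering G)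
    (x : Fin n → B.S) (u : Fin n) : (B.received pn x u).length = deg G u := by
  rw [received, List.length_map, pn.length_inList]

end Algo

/-- The algorithm `B Δ` produces a solution of `P` at time `T Δ`. -/
def AlgoSolves {Y : Type} (B : ∀ Δ : ℕ, Algo Y Δ) (P : GraphProblem Y) (T : ℕ → ℕ) : Prop :=
  ∀ (Δ n : ℕ) (G : SimpleGraph (Fin n)), (∀ v, deg G v ≤ Δ) → ∀ pn : PortNumbering G,
    ∃ S ∈ P n G, ∀ u, (B Δ).out ((B Δ).run pn (T Δ) u) = some (S u)

namespace DSM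

variable {Y : Type} {Δ : ℕ}

/-- A state machine as an algorithm. -/
abbrev toAlgo (A : DSM Y Δ) : Algo Y Δ where
  S := Y ⊕ A.Z
  M := A.M
  start d := A.z₀ ⟨min d Δ, Nat.lt_succ_of_le (min_le_right d Δ)⟩
  msg s j := if h : j < Δ then A.μ' s ⟨j, h⟩ else A.m₀
  step s a := A.δ' s fun k => (a k).getD A.m₀
  out := Sum.getLeft?

lemma exec_eq_run (A : DSM Y Δ) {n : ℕ} {G : SimpleGraph (Fin n)} (hG : ∀ v, deg G v ≤ Δ)
    (pn : PortNumbering G) (t : ℕ) (u : Fin n) :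
    exec A G hG pn t u = A.toAlgo.run pn t u := by
  induction t generalizing u with
  | zero => simp [exec, Algo.run, hG u]
  | succ t ih =>
    rw [exec, Algo.run, ih]
    refine congrArg (A.δ' _) (funext fun k => ?_)
    simp only [pad, Algo.received, PortNumbering.inList, List.map_ofFn, List.getElem?_ofFn]
    split_ifs with h
    · rw [ih]
      simp only [Function.comp, Option.getD_some]
      rw [dif_pos ((pn.p.symm ⟨u, ⟨k, h⟩⟩).2.isLt.trans_le (hG _))]
    · rfl

lemma solves_toAlgo {A : ∀ Δ : ℕ, DSM Y Δ} {P : GraphProblem Y} {T : ℕ → ℕ}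
    (h : SolvesInTime A P fun Δ _ => T Δ) : AlgoSolves (fun Δ => (A Δ).toAlgo) P T := by
  intro Δ n G hG pn
  obtain ⟨S, hS, hu⟩ := h Δ n G hG pn
  refine ⟨S, hS, fun u => ?_⟩
  rw [← exec_eq_run _ hG, hu u]
  rfl

lemma InMultiset.toAlgo {A : DSM Y Δ} (h : A.InMultiset) : A.toAlgo.InMultiset := by
  rintro (y | z) a b hab
  · rfl
  · apply h
    have := congrArg (Multiset.map fun o : Option A.M => o.getD A.m₀) hab
    rwa [Multiset.map_coe, Multiset.map_coe, List.map_ofFn, List.map_ofFn] at this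

lemma InBroadcast.μ'_eq {A : DSM Y Δ} (h : A.InBroadcast) (x : Y ⊕ A.Z) (i j : Fin Δ) :
    A.μ' x i = A.μ' x j := by
  rcases x with y | z
  · rfl
  · exact h z i j

lemma InBroadcast.toAlgo {A : DSM Y Δ} (h : A.InBroadcast) : A.toAlgo.InBroadcast := by
  intro s i j hi hj
  simp only [DSM.toAlgo, dif_pos hi, dif_pos hj]
  exact h.μ'_eq s _ _

lemma InSet.inMultiset {A : DSM Y Δ} (h : A.InSet) : A.InMultiset := by
  intro z a b hab
  apply h
  ext m
  have := congrArg (m ∈ ·) hab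
  simpa [List.mem_ofFn] using this

end DSM

namespace Algo

variable {Y : Type} {Δ : ℕ}

/-- The state at time `t` of the machine that stops at time `T`. -/
def emit (B : Algo Y Δ) (T t : ℕ) (s : B.S) : Y ⊕ (ℕ × B.S) :=
  if t = T then
    match B.out s with
    | some y => Sum.inl y
    | none => Sum.inr (t, s)
  else Sum.inr (t, s)

/-- The state machine that runs an algorithm for `T` rounds. -/
abbrev toDSM (B : Algo Y Δ) (T : ℕ) : DSM Y Δ where
  Z := ℕ × B.S
  z₀ d := B.emit T 0 (B.start d)
  M := Option B.M
  m₀ := none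
  μ z i := some (B.msg z.2 i)
  δ z a := B.emit T (z.1 + 1) (B.step z.2 a)

lemma exec_toDSM (B : Algo Y Δ) (T : ℕ) {n : ℕ} {G : SimpleGraph (Fin n)}
    (hG : ∀ v, deg G v ≤ Δ) (pn : PortNumbering G) (t : ℕ) (ht : t ≤ T) (u : Fin n) :
    exec (B.toDSM T) G hG pn t u = B.emit T t (B.run pn t u) := by
  induction t generalizing u with
  | zero => rfl
  | succ t ih =>
    have h1 : ∀ v, exec (B.toDSM T) G hG pn t v = Sum.inr (t, B.run pn t v) := by
      intro v
      rw [ih (by omega) v, emit, if_neg (by omega)]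
    rw [exec, h1, run]
    simp only [DSM.δ', toDSM]
    refine congrArg (fun a => B.emit T (t + 1) (B.step _ a)) (funext fun k => ?_)
    simp only [pad, received, PortNumbering.inList, List.map_ofFn, List.getElem?_ofFn]
    split_ifs with h
    · simp only [toDSM] at h1
      rw [h1]
      rfl
    · rfl

lemma solves_toDSM {B : ∀ Δ : ℕ, Algo Y Δ} {P : GraphProblem Y} {T : ℕ → ℕ}
    (h : AlgoSolves B P T) : SolvesInTime (fun Δ => (B Δ).toDSM (T Δ)) P fun Δ _ => T Δ := by
  intro Δ n G hG pn
  obtain ⟨S, hS, hu⟩ := h Δ n G hG pn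
  refine ⟨S, hS, fun u => ?_⟩
  rw [exec_toDSM _ _ hG pn _ le_rfl, emit, if_pos rfl]
  simp only [hu u]

lemma InMultiset.toDSM {B : Algo Y Δ} (h : B.InMultiset) (T : ℕ) : (B.toDSM T).InMultiset :=
  fun z a b hab => congrArg (B.emit T (z.1 + 1)) (h z.2 a b hab)

lemma InSet.toDSM {B : Algo Y Δ} (h : B.InSet) (T : ℕ) : (B.toDSM T).InSet :=
  fun z a b hab => congrArg (B.emit T (z.1 + 1)) (h z.2 a b hab)

lemma InBroadcast.toDSM {B : Algo Y Δ} (h : B.InBroadcast) (T : ℕ) :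
    (B.toDSM T).InBroadcast :=
  fun z i j => congrArg some (h z.2 i j i.isLt j.isLt)

end Algo

/-! ### Sorting message histories simulates port numbers -/

lemma cons_le_cons_iff_of_linearOrder {M : Type} [LinearOrder M] {a b : M} {l₁ l₂ : List M} :
    a :: l₁ ≤ b :: l₂ ↔ a < b ∨ a = b ∧ l₁ ≤ l₂ := by
  rw [le_iff_lt_or_eq, List.cons_lt_cons_iff, le_iff_lt_or_eq]
  grind

lemma take_le_take {M : Type} [LinearOrder M] {l₁ l₂ : List M} (h : l₁ ≤ l₂) (n : ℕ) :
    l₁.take n ≤ l₂.take n := by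
  induction n generalizing l₁ l₂ with
  | zero => simp
  | succ n ih =>
    rcases l₁ with _ | ⟨a, l₁⟩
    · exact not_lt.mp (by simp)
    · rcases l₂ with _ | ⟨b, l₂⟩
      · exact absurd h (not_le.mpr (by simp))
      · rw [List.take_succ_cons, List.take_succ_cons, cons_le_cons_iff_of_linearOrder]
        rcases cons_le_cons_iff_of_linearOrder.mp h with h | ⟨h, h'⟩
        · exact Or.inl h
        · exact Or.inr ⟨h, ih h'⟩

/-- The port numbering in which the incoming ports of each node are permuted. -/
def PortNumbering.permute {n : ℕ} {G : SimpleGraph (Fin n)} (pn : PortNumbering G)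
    (τ : ∀ u : Fin n, Equiv.Perm (Fin (deg G u))) : PortNumbering G where
  p := pn.p.trans (Equiv.sigmaCongrRight fun u => (τ u).symm)
  adj := pn.adj

lemma PortNumbering.inList_permute {n : ℕ} {G : SimpleGraph (Fin n)} (pn : PortNumbering G)
    (τ : ∀ u : Fin n, Equiv.Perm (Fin (deg G u))) (u : Fin n) :
    (pn.permute τ).inList u = List.ofFn fun k : Fin (deg G u) =>
      ((pn.p.symm ⟨u, τ u k⟩).1, ((pn.p.symm ⟨u, τ u k⟩).2 : ℕ)) :=
  rfl

namespace Algo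

variable {Y : Type} {Δ : ℕ}

open Classical in
/-- An arbitrary linear order on the messages. -/
noncomputable instance (B : Algo Y Δ) : LinearOrder B.M :=
  IsWellOrder.linearOrder WellOrderingRel

/-- The algorithm in which nodes send their histories, and use them to sort the messages. -/
noncomputable abbrev sorting (B : Algo Y Δ) : Algo Y Δ where
  S := List B.S × B.S
  M := List B.M
  start d := ([], B.start d)
  msg s j := (s.1 ++ [s.2]).map fun x => B.msg x j
  step s a := (s.1 ++ [s.2], B.step s.2 (pad Δ
    ((((List.ofFn a : Multiset (Option (List B.M))).filterMap id).sort (· ≤ ·)).filterMap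
      List.getLast?)))
  out s := B.out s.2

lemma sorting_inMultiset (B : Algo Y Δ) : B.sorting.InMultiset := by
  intro s a b h
  simp only [sorting]
  rw [h]

lemma InBroadcast.sorting {B : Algo Y Δ} (h : B.InBroadcast) : B.sorting.InBroadcast := by
  intro s i j hi hj
  simp only [Algo.sorting]
  exact List.map_congr_left fun x _ => h x i j hi hj

lemma run_sorting_fst (B : Algo Y Δ) {n : ℕ} {G : SimpleGraph (Fin n)} (pn : PortNumbering G)
    (t : ℕ) (u : Fin n) :
    (B.sorting.run pn t u).1 = (List.range t).map fun s => (B.sorting.run pn s u).2 := by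
  induction t with
  | zero => rfl
  | succ t ih =>
    rw [List.range_succ, List.map_append, ← ih]
    rfl

lemma msg_sorting (B : Algo Y Δ) {n : ℕ} {G : SimpleGraph (Fin n)} (pn : PortNumbering G)
    (t : ℕ) (u : Fin n) (j : ℕ) :
    B.sorting.msg (B.sorting.run pn t u) j =
      (List.range (t + 1)).map fun s => B.msg (B.sorting.run pn s u).2 j := by
  change (((B.sorting.run pn t u).1 ++ _).map _ : List B.M) = _
  rw [run_sorting_fst, List.range_succ, List.map_append, List.map_append, List.map_map]
  rfl

/-- The history received by `u` from its port `k` in round `t + 1`. -/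
noncomputable def history (B : Algo Y Δ) {n : ℕ} {G : SimpleGraph (Fin n)}
    (pn : PortNumbering G) (t : ℕ) (u : Fin n) (k : Fin (deg G u)) : List B.M :=
  B.sorting.msg (B.sorting.run pn t (pn.p.symm ⟨u, k⟩).1) (pn.p.symm ⟨u, k⟩).2

lemma history_eq_take (B : Algo Y Δ) {n : ℕ} {G : SimpleGraph (Fin n)} (pn : PortNumbering G)
    {t T : ℕ} (h : t ≤ T) (u : Fin n) (k : Fin (deg G u)) :
    B.history pn t u k = (B.history pn T u k).take (t + 1) := by
  rw [history, history, msg_sorting, msg_sorting, ← List.map_take, List.take_range,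
    min_eq_left (by omega)]

lemma getLast?_history (B : Algo Y Δ) {n : ℕ} {G : SimpleGraph (Fin n)} (pn : PortNumbering G)
    (t : ℕ) (u : Fin n) (k : Fin (deg G u)) :
    (B.history pn t u k).getLast? =
      some (B.msg (B.sorting.run pn t (pn.p.symm ⟨u, k⟩).1).2 (pn.p.symm ⟨u, k⟩).2) := by
  rw [history, msg_sorting, List.range_succ, List.map_append, List.map_singleton,
    List.getLast?_concat]

lemma run_sorting_snd (B : Algo Y Δ) {n : ℕ} {G : SimpleGraph (Fin n)}
    (hG : ∀ v, deg G v ≤ Δ) (pn : PortNumbering G) (t : ℕ) (u : Fin n)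
    (τ : Equiv.Perm (Fin (deg G u))) (hτ : Monotone (B.history pn t u ∘ τ)) :
    (B.sorting.run pn (t + 1) u).2 = B.step (B.sorting.run pn t u).2
      (pad Δ (List.ofFn fun k =>
        B.msg (B.sorting.run pn t (pn.p.symm ⟨u, τ k⟩).1).2 (pn.p.symm ⟨u, τ k⟩).2)) := by
  have h1 : ((List.ofFn (pad Δ (B.sorting.received pn (B.sorting.run pn t) u)) :
      Multiset (Option (List B.M))).filterMap id).sort (· ≤ ·) =
        List.ofFn (B.history pn t u ∘ τ) := by
    refine List.Perm.eq_of_pairwise (le := (· ≤ ·)) (fun a b _ _ => le_antisymm)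
      (Multiset.pairwise_sort _ _) (List.sortedLE_ofFn_iff.mpr hτ).pairwise ?_
    rw [← Multiset.coe_eq_coe, Multiset.sort_eq, Multiset.filterMap_coe]
    have h2 := reduceOption_ofFn_pad (Δ := Δ)
      (l := B.sorting.received pn (B.sorting.run pn t) u)
      (by rw [length_received]; exact hG u)
    rw [List.reduceOption] at h2
    rw [h2, received, PortNumbering.inList, List.map_ofFn, Multiset.coe_eq_coe]
    exact (Equiv.Perm.ofFn_comp_perm τ (B.history pn t u)).symm
  have h3 : (List.ofFn (B.history pn t u ∘ τ)).filterMap List.getLast? = List.ofFn fun k =>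
      B.msg (B.sorting.run pn t (pn.p.symm ⟨u, τ k⟩).1).2 (pn.p.symm ⟨u, τ k⟩).2 := by
    have h4 : List.ofFn (B.history pn t u ∘ τ) =
        (List.ofFn τ).map (B.history pn t u) := List.map_ofFn.symm
    rw [h4, List.filterMap_map]
    have h5 : List.getLast? ∘ B.history pn t u = fun k =>
        some (B.msg (B.sorting.run pn t (pn.p.symm ⟨u, k⟩).1).2 (pn.p.symm ⟨u, k⟩).2) :=
      funext fun k => B.getLast?_history pn t u k
    rw [h5, List.filterMap_eq_map', List.map_ofFn]
    rfl
  rw [← h3, ← h1]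
  rfl

/-- The run of the sorting algorithm is a run of the original algorithm in another port
numbering. -/
lemma exists_run_sorting (B : Algo Y Δ) (T : ℕ) {n : ℕ} {G : SimpleGraph (Fin n)}
    (hG : ∀ v, deg G v ≤ Δ) (pn : PortNumbering G) :
    ∃ pn' : PortNumbering G, ∀ t ≤ T, ∀ u, (B.sorting.run pn t u).2 = B.run pn' t u := by
  let τ : ∀ u : Fin n, Equiv.Perm (Fin (deg G u)) := fun u => Tuple.sort (B.history pn T u)
  have hτ : ∀ t ≤ T, ∀ u, Monotone (B.history pn t u ∘ τ u) := by
    intro t ht u a b hab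
    simp only [Function.comp, B.history_eq_take pn ht]
    exact take_le_take (Tuple.monotone_sort (B.history pn T u) hab) _
  refine ⟨pn.permute τ, fun t => ?_⟩
  induction t with
  | zero => exact fun _ _ => rfl
  | succ t ih =>
    intro ht u
    have ih := ih (by omega)
    rw [B.run_sorting_snd hG pn t u (τ u) (hτ t (by omega) u), run, received,
      PortNumbering.inList_permute, List.map_ofFn, ← ih u]
    simp only [ih]
    rfl

end Algo

lemma algoSolves_sorting {Y : Type} {B : ∀ Δ : ℕ, Algo Y Δ} {P : GraphProblem Y} {T : ℕ → ℕ}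
    (h : AlgoSolves B P T) : AlgoSolves (fun Δ => (B Δ).sorting) P T := by
  intro Δ n G hG pn
  obtain ⟨pn', hpn'⟩ := (B Δ).exists_run_sorting (T Δ) hG pn
  obtain ⟨S, hS, hu⟩ := h Δ n G hG pn'
  refine ⟨S, hS, fun u => ?_⟩
  rw [← hu u, ← hpn' _ le_rfl u]

/-! ### Refinement by sets separates neighbours -/

/-- Iterated refinement of a node colouring: `V (t + 1) u` determines `V t u` together with the
set of the colours of the neighbours of `u`, each tagged with the port `π · u` used to reach
`u`. -/
structure IsRefinement {n : ℕ} (G : SimpleGraph (Fin n)) (π : Fin n → Fin n → ℕ)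
    (V : ℕ → Fin n → ℕ) (T : ℕ) : Prop where
  prev : ∀ t < T, ∀ u w, V (t + 1) u = V (t + 1) w → V t u = V t w
  image : ∀ t < T, ∀ u w, V (t + 1) u = V (t + 1) w →
    (nbrs G u).image (fun v => (V t v, π v u)) = (nbrs G w).image fun v => (V t v, π v w)

namespace IsRefinement

variable {n : ℕ} {G : SimpleGraph (Fin n)} {π : Fin n → Fin n → ℕ} {V : ℕ → Fin n → ℕ} {T : ℕ}

/-- The neighbours of `v` with the same colour as `w`. -/
noncomputable def cls (G : SimpleGraph (Fin n)) (V : ℕ → Fin n → ℕ) (t : ℕ) (v w : Fin n) :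
    Finset (Fin n) :=
  (nbrs G v).filter fun x => V t x = V t w

lemma eq_of_le (h : IsRefinement G π V T) {s t : ℕ} (hst : s ≤ t) (ht : t ≤ T) {u w : Fin n}
    (huw : V t u = V t w) : V s u = V s w := by
  induction t, hst using Nat.le_induction with
  | base => exact huw
  | succ t _ ih => exact ih (by omega) (h.prev t (by omega) u w huw)

lemma card_cls_le (h : IsRefinement G π V T) (hπ : ∀ v, Set.InjOn (π v) (nbrs G v)) {t : ℕ}
    (ht : t < T) (v w : Fin n) :
    (cls G V (t + 1) v w).card ≤ ((cls G V t w v).image (π · w)).card := by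
  apply Finset.card_le_card_of_injOn (π v)
  · intro x hx
    obtain ⟨hx, hV⟩ := Finset.mem_filter.mp hx
    have hv : (V t v, π v x) ∈ (nbrs G x).image fun y => (V t y, π y x) :=
      Finset.mem_image_of_mem _ (mem_nbrs.mpr (mem_nbrs.mp hx).symm)
    rw [h.image t ht x w hV] at hv
    obtain ⟨y, hy, hyv⟩ := Finset.mem_image.mp hv
    obtain ⟨h1, h2⟩ := Prod.mk.inj hyv
    exact Finset.mem_image.mpr ⟨y, Finset.mem_filter.mpr ⟨hy, h1⟩, h2⟩
  · exact (hπ v).mono (Finset.coe_subset.mpr (Finset.filter_subset _ _))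

lemma card_image_lt (h : IsRefinement G π V T) {t : ℕ} (ht : t ≤ T) {u v w : Fin n}
    (hu : u ∈ nbrs G v) (hw : w ∈ nbrs G v) (huw : u ≠ w) (hV : V T u = V T w)
    (hp : π u v = π w v) :
    ((cls G V t v w).image (π · v)).card < (cls G V t v w).card := by
  refine lt_of_le_of_ne Finset.card_image_le fun hc => huw ?_
  refine Finset.card_image_iff.mp hc ?_ ?_ hp
  · exact Finset.mem_coe.mpr (Finset.mem_filter.mpr ⟨hu, h.eq_of_le ht le_rfl hV⟩)
  · exact Finset.mem_coe.mpr (Finset.mem_filter.mpr ⟨hw, rfl⟩)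

/-- After `2 * Δ` refinement steps, different neighbours of a node can be distinguished. -/
lemma separates {Δ : ℕ} (h : IsRefinement G π V (2 * Δ))
    (hπ : ∀ v, Set.InjOn (π v) (nbrs G v)) {u v w : Fin n} (hd : deg G v ≤ Δ)
    (hu : u ∈ nbrs G v) (hw : w ∈ nbrs G v) (hV : V (2 * Δ) u = V (2 * Δ) w)
    (hp : π u v = π w v) : u = w := by
  by_contra huw
  have hstep : ∀ k ≤ Δ, ((cls G V (2 * k) v w).image (π · v)).card + k <
      (nbrs G v).card := by
    intro k
    induction k with
    | zero =>
      intro _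
      exact (h.card_image_lt (t := 2 * 0) (by omega) hu hw huw hV hp).trans_le
        (Finset.card_le_card (Finset.filter_subset _ _))
    | succ k ih =>
      intro hk
      have h1 := h.card_image_lt (t := 2 * k + 1 + 1) (by omega) hu hw huw hV hp
      have h2 := h.card_cls_le hπ (t := 2 * k + 1) (by omega) v w
      have h3 : ((cls G V (2 * k + 1) w v).image (π · w)).card ≤ _ := Finset.card_image_le
      have h4 := h.card_cls_le hπ (t := 2 * k) (by omega) w v
      have h5 := ih (by omega)
      rw [show 2 * (k + 1) = 2 * k + 1 + 1 by ring]
      omega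
  have h1 := hstep Δ le_rfl
  rw [card_nbrs] at h1
  omega

end IsRefinement

/-! ### Simulating multisets by sets -/

open Classical in
/-- The set of the received messages. -/
noncomputable def contents {M : Type} {Δ : ℕ} (a : Fin Δ → Option M) : Finset M :=
  (Finset.univ.image a).eraseNone

lemma mem_contents {M : Type} {Δ : ℕ} {a : Fin Δ → Option M} {m : M} :
    m ∈ contents a ↔ some m ∈ Set.range a := by
  simp [contents]

namespace Algo

variable {Y : Type} {Δ : ℕ}

open Classical in
/-- The algorithm that first refines a colouring of the nodes for `2 * Δ` rounds, and then uses
the colours to tell the received messages apart. -/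
noncomputable abbrev tagging (B : Algo Y Δ) : Algo Y Δ where
  S := ℕ × ℕ × B.S
  M := (ℕ × ℕ) × B.M
  start d := (0, 0, B.start d)
  msg s j := ((s.2.1, j), B.msg s.2.2 j)
  step s a :=
    if s.1 < 2 * Δ then
      (s.1 + 1, Encodable.encode (s.2.1, (contents a).image Prod.fst), s.2.2)
    else
      (s.1 + 1, s.2.1, B.step s.2.2 (pad Δ ((contents a).toList.map Prod.snd)))
  out s := B.out s.2.2

lemma tagging_inSet (B : Algo Y Δ) : B.tagging.InSet := by
  intro s a b h
  have hc : contents a = contents b := by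
    ext m
    rw [mem_contents, mem_contents, h]
  simp only [hc]

section Tagging

variable (B : Algo Y Δ) {n : ℕ} {G : SimpleGraph (Fin n)} (pn : PortNumbering G)

/-- The colour of a node. -/
noncomputable def colour (t : ℕ) (u : Fin n) : ℕ := (B.tagging.run pn t u).2.1

lemma run_tagging_fst (t : ℕ) (u : Fin n) : (B.tagging.run pn t u).1 = t := by
  induction t with
  | zero => rfl
  | succ t ih =>
    rw [run]
    dsimp only
    split_ifs
    · rw [ih]
    · rw [ih]

lemma run_tagging_of_lt {t : ℕ} (ht : t < 2 * Δ) (u : Fin n) :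
    (B.tagging.run pn (t + 1) u).2.2 = (B.tagging.run pn t u).2.2 := by
  rw [run]
  dsimp only
  rw [if_pos (by rwa [run_tagging_fst])]

open Classical in
lemma contents_received (hG : ∀ v, deg G v ≤ Δ) (t : ℕ) (u : Fin n) :
    contents (pad Δ (B.tagging.received pn (B.tagging.run pn t) u)) =
      (B.tagging.received pn (B.tagging.run pn t) u).toFinset := by
  ext m
  rw [mem_contents, mem_range_pad (by rw [length_received]; exact hG u), List.mem_toFinset]

open Classical in
lemma image_contents_received (hG : ∀ v, deg G v ≤ Δ) (t : ℕ) (u : Fin n) :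
    (contents (pad Δ (B.tagging.received pn (B.tagging.run pn t) u))).image Prod.fst =
      (nbrs G u).image fun v => (B.colour pn t v, pn.outPort v u) := by
  rw [contents_received B pn hG]
  ext c
  rw [Finset.mem_image, Finset.mem_image]
  constructor
  · rintro ⟨m, hm, rfl⟩
    obtain ⟨⟨v, i⟩, hv, rfl⟩ := List.mem_map.mp (List.mem_toFinset.mp hm)
    obtain ⟨h1, rfl⟩ := pn.mem_inList.mp hv
    exact ⟨v, h1, rfl⟩
  · rintro ⟨v, hv, rfl⟩
    exact ⟨_, List.mem_toFinset.mpr (List.mem_map_of_mem (pn.mem_inList.mpr ⟨hv, rfl⟩)), rfl⟩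

lemma colour_of_lt (hG : ∀ v, deg G v ≤ Δ) {t : ℕ} (ht : t < 2 * Δ) (u : Fin n) :
    B.colour pn (t + 1) u = Encodable.encode (B.colour pn t u,
      (nbrs G u).image fun v => (B.colour pn t v, pn.outPort v u)) := by
  classical
  rw [colour, run]
  dsimp only
  rw [if_pos (by rwa [run_tagging_fst])]
  refine congrArg (fun s => Encodable.encode (_, s)) ?_
  convert image_contents_received B pn hG t u using 1

lemma isRefinement_colour (hG : ∀ v, deg G v ≤ Δ) :
    IsRefinement G pn.outPort (B.colour pn) (2 * Δ) where
  prev t ht u w h := by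
    rw [colour_of_lt B pn hG ht, colour_of_lt B pn hG ht] at h
    exact (Prod.mk.inj (Encodable.encode_injective h)).1
  image t ht u w h := by
    rw [colour_of_lt B pn hG ht, colour_of_lt B pn hG ht] at h
    exact (Prod.mk.inj (Encodable.encode_injective h)).2

lemma colour_of_le {t : ℕ} (ht : 2 * Δ ≤ t) (u : Fin n) :
    B.colour pn t u = B.colour pn (2 * Δ) u := by
  induction t, ht using Nat.le_induction with
  | base => rfl
  | succ t ht ih =>
    rw [← ih, colour, run]
    dsimp only
    rw [if_neg (by rw [run_tagging_fst]; omega)]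
    rfl

lemma nodup_received_tagging (hG : ∀ v, deg G v ≤ Δ) {t : ℕ} (ht : 2 * Δ ≤ t) (u : Fin n) :
    (B.tagging.received pn (B.tagging.run pn t) u).Nodup := by
  refine List.Nodup.map_on ?_ (pn.nodup_inList u)
  rintro ⟨v, i⟩ hv ⟨w, j⟩ hw h
  obtain ⟨hv', rfl⟩ := pn.mem_inList.mp hv
  obtain ⟨hw', rfl⟩ := pn.mem_inList.mp hw
  obtain ⟨h1, h2⟩ := Prod.mk.inj (Prod.mk.inj h).1
  have h3 : B.colour pn t v = B.colour pn t w := h1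
  rw [colour_of_le B pn ht, colour_of_le B pn ht] at h3
  rw [(B.isRefinement_colour pn hG).separates pn.outPort_injOn (hG u) hv' hw' h3 h2]

lemma run_tagging_of_le (hB : B.InMultiset) (hG : ∀ v, deg G v ≤ Δ) {t : ℕ}
    (ht : 2 * Δ ≤ t) (u : Fin n) :
    (B.tagging.run pn (t + 1) u).2.2 = B.step (B.tagging.run pn t u).2.2
      (pad Δ (B.received pn (fun v => (B.tagging.run pn t v).2.2) u)) := by
  classical
  rw [run]
  dsimp only
  rw [if_neg (by rw [run_tagging_fst]; omega)]
  have hp := (List.toFinset_toList (nodup_received_tagging B pn hG ht u)).map Prod.snd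
  have hr : (B.tagging.received pn (B.tagging.run pn t) u).map Prod.snd =
      B.received pn (fun v => (B.tagging.run pn t v).2.2) u := by
    rw [received, received, List.map_map]
    rfl
  rw [hr] at hp
  rw [contents_received B pn hG]
  refine hB _ _ _ (coe_ofFn_pad_eq hp ?_)
  rw [hp.length_eq, length_received]
  exact hG u

lemma run_tagging (hB : B.InMultiset) (hG : ∀ v, deg G v ≤ Δ) (t : ℕ) (u : Fin n) :
    (B.tagging.run pn (2 * Δ + t) u).2.2 = B.run pn t u := by
  induction t generalizing u with
  | zero =>
    have h : ∀ s ≤ 2 * Δ, (B.tagging.run pn s u).2.2 = B.start (deg G u) := by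
      intro s
      induction s with
      | zero => exact fun _ => rfl
      | succ s ih =>
        intro hs
        rw [run_tagging_of_lt B pn hs, ih (by omega)]
    exact h _ le_rfl
  | succ t ih =>
    rw [← add_assoc, run_tagging_of_le B pn hB hG (by omega), run, ih]
    simp only [ih]

end Tagging

end Algo

lemma algoSolves_tagging {Y : Type} {B : ∀ Δ : ℕ, Algo Y Δ} {P : GraphProblem Y} {T : ℕ → ℕ}
    (hB : ∀ Δ, (B Δ).InMultiset) (h : AlgoSolves B P T) :
    AlgoSolves (fun Δ => (B Δ).tagging) P fun Δ => 2 * Δ + T Δ := by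
  intro Δ n G hG pn
  obtain ⟨S, hS, hu⟩ := h Δ n G hG pn
  refine ⟨S, hS, fun u => ?_⟩
  rw [← hu u, ← (B Δ).run_tagging pn (hB Δ) hG]

/-! ### Inclusions between the classes -/

section Inclusions

variable {Y : Type} {P : GraphProblem Y}

lemma SB1.mB1 (h : SB1 P) : MB1 P := by
  obtain ⟨A, hA, hT⟩ := h
  exact ⟨A, fun Δ => ⟨(hA Δ).1.inMultiset, (hA Δ).2⟩, hT⟩

lemma MB1.vB1 (h : MB1 P) : VB1 P := by
  obtain ⟨A, hA, hT⟩ := h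
  exact ⟨A, fun Δ => (hA Δ).2, hT⟩

lemma VB1.mB1 (h : VB1 P) : MB1 P := by
  obtain ⟨A, hA, T, hT⟩ := h
  exact ⟨fun Δ => (A Δ).toAlgo.sorting.toDSM (T Δ), fun Δ =>
    ⟨(A Δ).toAlgo.sorting_inMultiset.toDSM _, (hA Δ).toAlgo.sorting.toDSM _⟩, T,
    Algo.solves_toDSM (algoSolves_sorting (DSM.solves_toAlgo hT))⟩

lemma VB1.vV1 (h : VB1 P) : VV1 P := by
  obtain ⟨A, _, hT⟩ := h
  exact ⟨A, hT⟩

lemma VV1.mV1 (h : VV1 P) : MV1 P := by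
  obtain ⟨A, T, hT⟩ := h
  exact ⟨fun Δ => (A Δ).toAlgo.sorting.toDSM (T Δ), fun Δ =>
    (A Δ).toAlgo.sorting_inMultiset.toDSM _, T,
    Algo.solves_toDSM (algoSolves_sorting (DSM.solves_toAlgo hT))⟩

lemma MV1.sV1 (h : MV1 P) : SV1 P := by
  obtain ⟨A, hA, T, hT⟩ := h
  exact ⟨fun Δ => (A Δ).toAlgo.tagging.toDSM (2 * Δ + T Δ), fun Δ =>
    (A Δ).toAlgo.tagging_inSet.toDSM _, fun Δ => 2 * Δ + T Δ,
    Algo.solves_toDSM (algoSolves_tagging (fun Δ => (hA Δ).toAlgo) (DSM.solves_toAlgo hT))⟩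

lemma SV1.mV1 (h : SV1 P) : MV1 P := by
  obtain ⟨A, hA, hT⟩ := h
  exact ⟨A, fun Δ => (hA Δ).inMultiset, hT⟩

lemma MV1.vV1 (h : MV1 P) : VV1 P := by
  obtain ⟨A, _, hT⟩ := h
  exact ⟨A, hT⟩

lemma VV1.vVc1 (h : VV1 P) : VVc1 P := by
  obtain ⟨A, T, hT⟩ := h
  exact ⟨A, T, fun Δ n G hG pn _ => hT Δ n G hG pn⟩

end Inclusions

/-! ### Port numberings from local orderings -/

section OfEquiv

variable {n : ℕ} {G : SimpleGraph (Fin n)}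

lemma port_ext {q r : Port G} (h₁ : q.1 = r.1) (h₂ : (q.2 : ℕ) = r.2) : q = r := by
  obtain ⟨v, i⟩ := q
  obtain ⟨w, j⟩ := r
  obtain rfl : v = w := h₁
  obtain rfl : i = j := Fin.ext h₂
  rfl

lemma port_symm_eq (e : ∀ v, Fin (deg G v) ≃ {u // G.Adj v u}) {v : Fin n} (i : Fin (deg G v))
    (x : {w // G.Adj (e v i).1 w}) (hx : x = ⟨v, (e v i).2.symm⟩) :
    (⟨x.1, (e x.1).symm ⟨(e v i).1, x.2.symm⟩⟩ : Port G) = ⟨v, i⟩ := by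
  subst hx
  exact congrArg (Sigma.mk v) ((e v).symm_apply_apply i)

/-- The port numbering determined by an ordering `e` of the outgoing ports and an ordering `f` of
the incoming ports of every node. -/
def PortNumbering.ofEquiv (e f : ∀ v, Fin (deg G v) ≃ {u // G.Adj v u}) : PortNumbering G where
  p :=
    { toFun := fun q => ⟨(e q.1 q.2).1, (f _).symm ⟨q.1, (e q.1 q.2).2.symm⟩⟩
      invFun := fun q => ⟨(f q.1 q.2).1, (e _).symm ⟨q.1, (f q.1 q.2).2.symm⟩⟩
      left_inv := fun ⟨v, i⟩ => port_symm_eq e i _ ((f _).apply_symm_apply _)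
      right_inv := fun ⟨v, i⟩ => port_symm_eq f i _ ((e _).apply_symm_apply _) }
  adj u v := by
    constructor
    · rintro ⟨i, rfl⟩
      exact (e u i).2
    · intro h
      exact ⟨(e u).symm ⟨v, h⟩, congrArg Subtype.val ((e u).apply_symm_apply ⟨v, h⟩)⟩

lemma nonempty_portNumbering (G : SimpleGraph (Fin n)) : Nonempty (PortNumbering G) :=
  ⟨PortNumbering.ofEquiv (fun _ => (Finite.equivFin _).symm) fun _ => (Finite.equivFin _).symm⟩

end OfEquiv

/-! ### Indistinguishable nodes -/

section Indistinguishable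

variable {Y : Type} {Δ n : ℕ} {G : SimpleGraph (Fin n)}

/-- A broadcast machine based on sets cannot tell apart nodes of the same degree if all nodes of
the same degree see the same set of degrees in their neighbourhoods. -/
lemma exec_eq_of_deg_eq {A : DSM Y Δ} (hA : A.InSet) (hB : A.InBroadcast)
    (hG : ∀ v, deg G v ≤ Δ) (pn : PortNumbering G)
    (hdeg : ∀ u w v, deg G u = deg G w → G.Adj u v → ∃ v', G.Adj w v' ∧ deg G v = deg G v')
    (t : ℕ) (u w : Fin n) (h : deg G u = deg G w) :
    exec A G hG pn t u = exec A G hG pn t w := by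
  induction t generalizing u w with
  | zero => simp only [exec, h]
  | succ t ih =>
    have hδ : ∀ (x : Y ⊕ A.Z) (a b : Fin Δ → A.M), Set.range a = Set.range b →
        A.δ' x a = A.δ' x b := by
      rintro (y | z) a b hab
      · rfl
      · exact hA z a b hab
    rw [exec, exec, ih u w h]
    apply hδ
    have key : ∀ u w, deg G u = deg G w →
        (Set.range fun k : Fin Δ =>
          if h : (k : ℕ) < deg G u then
            A.μ' (exec A G hG pn t (pn.p.symm ⟨u, ⟨(k : ℕ), h⟩⟩).1)
              ⟨((pn.p.symm ⟨u, ⟨(k : ℕ), h⟩⟩).2 : ℕ),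
                lt_of_lt_of_le (pn.p.symm ⟨u, ⟨(k : ℕ), h⟩⟩).2.isLt (hG _)⟩
          else A.m₀) ⊆
        Set.range fun k : Fin Δ =>
          if h : (k : ℕ) < deg G w then
            A.μ' (exec A G hG pn t (pn.p.symm ⟨w, ⟨(k : ℕ), h⟩⟩).1)
              ⟨((pn.p.symm ⟨w, ⟨(k : ℕ), h⟩⟩).2 : ℕ),
                lt_of_lt_of_le (pn.p.symm ⟨w, ⟨(k : ℕ), h⟩⟩).2.isLt (hG _)⟩
          else A.m₀ := by
      rintro u w h _ ⟨k, rfl⟩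
      by_cases hk : (k : ℕ) < deg G u
      · obtain ⟨v', hv', hd⟩ := hdeg u w _ h ((pn.adj_symm u _).mp ⟨⟨k, hk⟩, rfl⟩)
        obtain ⟨k', rfl⟩ := (pn.adj_symm w v').mpr hv'
        refine ⟨⟨k', k'.isLt.trans_le (hG w)⟩, ?_⟩
        dsimp only
        rw [dif_pos hk, dif_pos k'.isLt, ih _ _ hd]
        exact hB.μ'_eq _ _ _
      · refine ⟨k, ?_⟩
        dsimp only
        rw [dif_neg hk, dif_neg (h ▸ hk)]
    exact (key u w h).antisymm (key w u h.symm)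

/-- A broadcast machine cannot tell apart two leaves with a common neighbour. -/
lemma exec_eq_of_leaves {A : DSM Y Δ} (hB : A.InBroadcast) (hG : ∀ v, deg G v ≤ Δ)
    (pn : PortNumbering G) {u w c : Fin n} (hu : deg G u = 1) (hw : deg G w = 1)
    (huc : ∀ v, G.Adj u v → v = c) (hwc : ∀ v, G.Adj w v → v = c) (t : ℕ) :
    exec A G hG pn t u = exec A G hG pn t w := by
  induction t with
  | zero => simp only [exec, hu, hw]
  | succ t ih =>
    rw [exec, exec, ih]
    refine congrArg _ (funext fun k => ?_)
    by_cases hk : (k : ℕ) < 1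
    · rw [dif_pos (hu ▸ hk), dif_pos (hw ▸ hk),
        hB.μ'_eq _ _ k,
        huc _ ((pn.adj_symm u _).mp ⟨⟨k, hu ▸ hk⟩, rfl⟩),
        hB.μ'_eq (exec A G hG pn t (pn.p.symm ⟨w, _⟩).1) _ k,
        hwc _ ((pn.adj_symm w _).mp ⟨⟨k, hw ▸ hk⟩, rfl⟩)]
    · rw [dif_neg (hu ▸ hk), dif_neg (hw ▸ hk)]

/-- In a regular graph in which every edge joins ports of equal index, all nodes behave in the
same way. -/
lemma exec_eq_of_regular (A : DSM Y Δ) (hG : ∀ v, deg G v ≤ Δ) (pn : PortNumbering G)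
    {d : ℕ} (hd : ∀ v, deg G v = d)
    (hp : ∀ u (k : Fin (deg G u)), ((pn.p.symm ⟨u, k⟩).2 : ℕ) = k)
    (t : ℕ) (u w : Fin n) : exec A G hG pn t u = exec A G hG pn t w := by
  induction t generalizing u w with
  | zero => simp only [exec, hd]
  | succ t ih =>
    rw [exec, exec, ih u w]
    refine congrArg _ (funext fun k => ?_)
    by_cases hk : (k : ℕ) < d
    · rw [dif_pos ((hd u).symm ▸ hk), dif_pos ((hd w).symm ▸ hk), ih _ (pn.p.symm ⟨w, _⟩).1]
      exact congrArg _ (Fin.ext ((hp u _).trans (hp w ⟨k, (hd w).symm ▸ hk⟩).symm))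
    · rw [dif_neg ((hd u).symm ▸ hk), dif_neg ((hd w).symm ▸ hk)]

end Indistinguishable

/-! ### Separation of SB(1) and MB(1) -/

section UniqueLeaf

/-- The problem of deciding whether a node has exactly one neighbour of degree one. -/
def uniqueLeaf : GraphProblem Bool := fun _ G =>
  {S | ∀ u, S u = true ↔ ((nbrs G u).filter fun v => 1 = deg G v).card = 1}

/-- Count the neighbours of degree one. -/
abbrev uniqueLeafAlgo (Δ : ℕ) : Algo Bool Δ where
  S := ℕ × Bool
  M := ℕ
  start d := (d, false)
  msg s _ := s.1
  step s a := (s.1, decide ((List.ofFn a).reduceOption.count 1 = 1))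
  out s := some s.2

lemma algoSolves_uniqueLeaf : AlgoSolves uniqueLeafAlgo uniqueLeaf fun _ => 1 := by
  intro Δ n G hG pn
  refine ⟨fun u => ((uniqueLeafAlgo Δ).run pn 1 u).2, ?_, fun u => rfl⟩
  intro u
  refine decide_eq_true_iff.trans ?_
  rw [reduceOption_ofFn_pad (by rw [Algo.length_received]; exact hG u)]
  rw [← Multiset.coe_count, Algo.received, ← Multiset.map_coe, pn.coe_inList,
    Multiset.map_map, Multiset.count_map]
  rfl

lemma mB1_uniqueLeaf : MB1 uniqueLeaf := by
  refine ⟨fun Δ => (uniqueLeafAlgo Δ).toDSM 1, fun Δ => ⟨Algo.InMultiset.toDSM ?_ 1,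
    Algo.InBroadcast.toDSM ?_ 1⟩, _, Algo.solves_toDSM algoSolves_uniqueLeaf⟩
  · intro s a b h
    have hp : (List.ofFn a).reduceOption.Perm (List.ofFn b).reduceOption :=
      (Multiset.coe_eq_coe.mp h).filterMap id
    simp only [hp.count_eq]
  · exact fun _ _ _ _ _ => rfl

/-- A tree in which the nodes `0`, `1` and `2` have degree three and all other nodes are leaves. -/
def caterpillar : SimpleGraph (Fin 8) :=
  SimpleGraph.fromRel fun u v =>
    (u, v) ∈ [(0, 1), (1, 2), (1, 3), (0, 4), (0, 5), (2, 6), (2, 7)]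

instance : DecidableRel caterpillar.Adj := by
  unfold caterpillar
  infer_instance

lemma deg_caterpillar (v : Fin 8) : deg caterpillar v = if v < 3 then 3 else 1 := by
  rw [deg_eq_of_decidable]
  revert v
  decide

lemma not_sB1_uniqueLeaf : ¬ SB1 uniqueLeaf := by
  rintro ⟨A, hA, T, hT⟩
  obtain ⟨pn⟩ := nonempty_portNumbering caterpillar
  have hG : ∀ v, deg caterpillar v ≤ 3 := by
    intro v
    rw [deg_caterpillar]
    split_ifs <;> omega
  obtain ⟨S, hS, hu⟩ := hT 3 8 caterpillar hG pn
  have h := exec_eq_of_deg_eq (hA 3).1 (hA 3).2 hG pn (by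
    simp only [deg_caterpillar]
    decide) (T 3) 0 1 (by simp only [deg_caterpillar]; decide)
  rw [hu 0, hu 1, Sum.inl.injEq] at h
  have h0 := hS 0
  have h1 := hS 1
  rw [h, h1] at h0
  have hn : ∀ u, (nbrs caterpillar u).filter (fun v => 1 = deg caterpillar v) =
      Finset.univ.filter fun v => caterpillar.Adj u v ∧ 1 = if v < 3 then 3 else 1 := by
    intro u
    ext v
    rw [Finset.mem_filter, mem_nbrs, Finset.mem_filter, deg_caterpillar]
    simp
  rw [hn, hn] at h0
  revert h0
  decide

end UniqueLeaf

/-! ### Separation of VB(1) and SV(1) -/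

section StarLeader

/-- The problem of selecting exactly one leaf in every star. -/
def starLeader : GraphProblem Bool := fun _ G =>
  {S | ∀ v, 0 < deg G v → (∀ u, G.Adj v u → deg G u = 1) → ∃! u, G.Adj v u ∧ S u = true}

/-- Select the nodes that are reached from a port of index zero. -/
noncomputable abbrev starLeaderAlgo (Δ : ℕ) : Algo Bool Δ where
  S := Bool
  M := ℕ
  start _ := false
  msg _ j := j
  step _ a := decide (∃ k, a k = some 0)
  out := some

lemma algoSolves_starLeader : AlgoSolves starLeaderAlgo starLeader fun _ => 1 := by
  intro Δ n G hG pn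
  refine ⟨(starLeaderAlgo Δ).run pn 1, ?_, fun u => rfl⟩
  have hS : ∀ u, (starLeaderAlgo Δ).run pn 1 u = true ↔ ∃ v, G.Adj u v ∧ pn.outPort v u = 0 := by
    intro u
    rw [Algo.run, decide_eq_true_iff]
    refine (mem_range_pad (by rw [Algo.length_received]; exact hG u) 0).trans ?_
    rw [Algo.received, List.mem_map]
    constructor
    · rintro ⟨⟨v, i⟩, hv, hi⟩
      obtain ⟨h1, rfl⟩ := pn.mem_inList.mp hv
      exact ⟨v, mem_nbrs.mp h1, hi⟩
    · rintro ⟨v, hv, hi⟩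
      exact ⟨(v, pn.outPort v u), pn.mem_inList.mpr ⟨mem_nbrs.mpr hv, rfl⟩, hi⟩
  intro v hv hleaf
  have h0 : G.Adj v (pn.p ⟨v, ⟨0, hv⟩⟩).1 := (pn.adj v _).mp ⟨_, rfl⟩
  refine ⟨(pn.p ⟨v, ⟨0, hv⟩⟩).1, ⟨h0, (hS _).mpr ⟨v, h0.symm, pn.outPort_target v _⟩⟩, ?_⟩
  rintro u ⟨hu, hSu⟩
  obtain ⟨w, hw, h2⟩ := (hS u).mp hSu
  have hc : (nbrs G u).card ≤ 1 := by rw [card_nbrs, hleaf u hu]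
  obtain rfl : w = v :=
    Finset.card_le_one.mp hc _ (mem_nbrs.mpr hw) _ (mem_nbrs.mpr hu.symm)
  exact pn.outPort_injOn w (mem_nbrs.mpr hu) (mem_nbrs.mpr h0)
    (h2.trans (pn.outPort_target w ⟨0, hv⟩).symm)

lemma sV1_starLeader : SV1 starLeader := by
  refine ⟨fun Δ => (starLeaderAlgo Δ).toDSM 1, fun Δ => Algo.InSet.toDSM ?_ 1, _,
    Algo.solves_toDSM algoSolves_starLeader⟩
  intro s a b h
  have h0 : (∃ k, a k = some 0) ↔ ∃ k, b k = some 0 := Set.ext_iff.mp h (some 0)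
  simp only [h0]

/-- The path with three nodes and center `0`. -/
def twoStar : SimpleGraph (Fin 3) := SimpleGraph.fromRel fun u _ => u = 0

instance : DecidableRel twoStar.Adj := by
  unfold twoStar
  infer_instance

lemma deg_twoStar (v : Fin 3) : deg twoStar v = if v = 0 then 2 else 1 := by
  rw [deg_eq_of_decidable]
  revert v
  decide

lemma not_vB1_starLeader : ¬ VB1 starLeader := by
  rintro ⟨A, hA, T, hT⟩
  obtain ⟨pn⟩ := nonempty_portNumbering twoStar
  have hG : ∀ v, deg twoStar v ≤ 2 := by
    intro v
    rw [deg_twoStar]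
    split_ifs <;> omega
  obtain ⟨S, hS, hu⟩ := hT 2 3 twoStar hG pn
  have h := exec_eq_of_leaves (hA 2) hG pn (u := 1) (w := 2) (c := 0)
    (by rw [deg_twoStar]; rfl) (by rw [deg_twoStar]; rfl) (by decide) (by decide) (T 2)
  rw [hu 1, hu 2, Sum.inl.injEq] at h
  obtain ⟨u, ⟨h1, h2⟩, h3⟩ := hS 0 (by rw [deg_twoStar]; decide)
    (by simp only [deg_twoStar]; decide)
  have hu12 : u = 1 ∨ u = 2 := by
    have h : ∀ u, twoStar.Adj 0 u → u = 1 ∨ u = 2 := by decide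
    exact h u h1
  have hS1 : S 1 = true := by
    rcases hu12 with rfl | rfl
    · exact h2
    · exact h.trans h2
  have e1 := h3 1 ⟨by decide, hS1⟩
  have e2 := h3 2 ⟨by decide, h ▸ hS1⟩
  exact absurd (e1.trans e2.symm) (by decide)

end StarLeader

/-! ### Separation of VV(1) and VVc(1) -/

section SymmetryBreaking

/-- The problem of producing a non-constant output in every cubic graph without a perfect
matching. -/
def symmetryBreaking : GraphProblem (Fin 3 → Fin 3) := fun _ G =>
  {S | (∀ v, deg G v = 3) → (¬ ∃ f : Fin _ → Fin _, Function.Involutive f ∧ ∀ v, G.Adj v (f v)) →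
    ¬ ∃ c, ∀ v, S v = c}

/-- Output the indices of the ports that are connected to the ports of the node. -/
abbrev symmetryBreakingAlgo (Δ : ℕ) : Algo (Fin 3 → Fin 3) Δ where
  S := Fin 3 → Fin 3
  M := ℕ
  start _ := 0
  msg _ j := j
  step _ a := fun k => if h : (k : ℕ) < Δ then Fin.ofNat 3 ((a ⟨k, h⟩).getD 0) else 0
  out := some

lemma vVc1_symmetryBreaking : VVc1 symmetryBreaking := by
  refine ⟨fun Δ => (symmetryBreakingAlgo Δ).toDSM 1, fun _ => 1, ?_⟩
  intro Δ n G hG pn hpn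
  refine ⟨(symmetryBreakingAlgo Δ).run pn 1, ?_, fun u => ?_⟩
  · rintro h3 hf ⟨c, hc⟩
    have hlt : ∀ v (k : Fin 3), (k : ℕ) < deg G v := fun v k => (h3 v).symm ▸ k.isLt
    have hp : ∀ v (k : Fin 3), ((pn.p ⟨v, ⟨k, hlt v k⟩⟩).2 : ℕ) = c k := by
      intro v k
      have hs : pn.p.symm ⟨v, ⟨k, hlt v k⟩⟩ = pn.p ⟨v, ⟨k, hlt v k⟩⟩ := by
        rw [Equiv.symm_apply_eq, hpn]
      have hlt3 : ((pn.p ⟨v, ⟨k, hlt v k⟩⟩).2 : ℕ) < 3 :=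
        (pn.p ⟨v, ⟨k, hlt v k⟩⟩).2.isLt.trans_eq (h3 _)
      rw [← hc v, Algo.run]
      simp only [dif_pos ((hlt v k).trans_le (hG v)), pad, Algo.received, PortNumbering.inList,
        List.map_ofFn, List.getElem?_ofFn, dif_pos (hlt v k), Option.getD_some,
        Function.comp, Fin.val_ofNat]
      rw [hs, Nat.mod_eq_of_lt hlt3]
    have hpp : ∀ v (k : Fin 3), pn.p ⟨v, ⟨k, hlt v k⟩⟩ =
        ⟨(pn.p ⟨v, ⟨k, hlt v k⟩⟩).1, ⟨c k, hlt _ _⟩⟩ := fun v k => port_ext rfl (hp v k)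
    rcases n.eq_zero_or_pos with rfl | hn
    · exact hf ⟨id, fun _ => rfl, fun v => v.elim0⟩
    have hcc : ∀ k, c (c k) = k := by
      intro k
      have h := hpn ⟨⟨0, hn⟩, ⟨k, hlt _ k⟩⟩
      rw [hpp, hpp] at h
      have h' := congrArg (fun q : Port G => (q.2 : ℕ)) h
      exact Fin.ext h'
    have hfix : ∀ c : Fin 3 → Fin 3, (∀ k, c (c k) = k) → ∃ k, c k = k := by decide
    obtain ⟨k, hk⟩ := hfix c hcc
    refine hf ⟨fun v => (pn.p ⟨v, ⟨k, hlt v k⟩⟩).1, fun v => ?_, fun v => ?_⟩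
    · have h := hpn ⟨v, ⟨k, hlt _ k⟩⟩
      rw [hpp v k] at h
      simp only [hk] at h
      exact congrArg Sigma.fst h
    · exact (pn.adj v _).mp ⟨_, rfl⟩
  · rw [Algo.exec_toDSM _ _ hG pn _ le_rfl, Algo.emit, if_pos rfl]

/-- The edges of the cubic graph `gadgets`, oriented and split into three permutations. -/
def out (i : Fin 3) (v : Fin 16) : Fin 16 :=
  (![![15, 4, 3, 1, 2, 7, 9, 5, 6, 8, 11, 13, 10, 14, 12, 0],
    ![2, 3, 0, 4, 1, 6, 5, 8, 9, 7, 15, 14, 13, 12, 11, 10],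
    ![1, 0, 4, 2, 3, 15, 8, 9, 7, 6, 12, 10, 14, 11, 13, 5]] : Fin 3 → Fin 16 → Fin 16) i v

/-- The inverses of the permutations `out`. -/
def into (i : Fin 3) (v : Fin 16) : Fin 16 :=
  (![![15, 3, 4, 2, 1, 7, 8, 5, 9, 6, 12, 10, 14, 11, 13, 0],
    ![2, 4, 0, 1, 3, 6, 5, 9, 7, 8, 15, 14, 13, 12, 11, 10],
    ![1, 0, 3, 4, 2, 15, 9, 8, 6, 7, 11, 13, 10, 14, 12, 5]] : Fin 3 → Fin 16 → Fin 16) i v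

/-- A cubic graph that consists of the center `15`, which is a cut vertex, and three components
with five nodes each. -/
def gadgets : SimpleGraph (Fin 16) where
  Adj u v := ∃ i, out i u = v
  symm := ⟨by decide⟩
  loopless := ⟨by decide⟩

instance : DecidableRel gadgets.Adj := fun u v => inferInstanceAs (Decidable (∃ i, out i u = v))

lemma adj_into (v : Fin 16) (i : Fin 3) : gadgets.Adj v (into i v) := by
  revert v i
  decide

/-- The neighbours of a node in the order given by `out`. -/
noncomputable def outEquiv (v : Fin 16) : Fin 3 ≃ {u // gadgets.Adj v u} :=
  Equiv.ofBijective (fun i => ⟨out i v, i, rfl⟩) (by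
    constructor
    · intro i j hij
      have h : ∀ v i j, out i v = out j v → i = j := by decide
      exact h v i j (congrArg Subtype.val hij)
    · rintro ⟨_, i, rfl⟩
      exact ⟨i, rfl⟩)

/-- The neighbours of a node in the order given by `into`. -/
noncomputable def intoEquiv (v : Fin 16) : Fin 3 ≃ {u // gadgets.Adj v u} :=
  Equiv.ofBijective (fun i => ⟨into i v, adj_into v i⟩) (by
    constructor
    · intro i j hij
      have h : ∀ v i j, into i v = into j v → i = j := by decide
      exact h v i j (congrArg Subtype.val hij)
    · rintro ⟨u, hu⟩
      have h : ∀ v u, gadgets.Adj v u → ∃ i, into i v = u := by decide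
      obtain ⟨i, hi⟩ := h v u hu
      exact ⟨i, Subtype.ext hi⟩)

lemma deg_gadgets (v : Fin 16) : deg gadgets v = 3 := by
  rw [deg, ← Nat.card_congr (outEquiv v), Nat.card_fin]

/-- A port numbering of `gadgets` in which every edge joins ports of equal index. -/
noncomputable def gadgetsPorts : PortNumbering gadgets :=
  PortNumbering.ofEquiv (fun v => (finCongr (deg_gadgets v)).trans (outEquiv v))
    fun v => (finCongr (deg_gadgets v)).trans (intoEquiv v)

lemma gadgetsPorts_symm (u : Fin 16) (k : Fin (deg gadgets u)) :
    ((gadgetsPorts.p.symm ⟨u, k⟩).2 : ℕ) = k := by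
  set i : Fin 3 := finCongr (deg_gadgets u) k with hi
  have h : ∀ u i, out i (into i u) = u := by decide
  have h1 : outEquiv (into i u) i = ⟨u, (adj_into u i).symm⟩ := Subtype.ext (h u i)
  have h2 : (outEquiv (into i u)).symm ⟨u, (adj_into u i).symm⟩ = i := by
    rw [← h1, Equiv.symm_apply_apply]
  have h3 : ((gadgetsPorts.p.symm ⟨u, k⟩).2 : ℕ) =
      ((outEquiv (into i u)).symm ⟨u, (adj_into u i).symm⟩ : ℕ) := rfl
  rw [h3, h2, hi]
  rfl

lemma even_card_of_involutive {α : Type*} {f : α → α} (hf : Function.Involutive f)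
    (hne : ∀ a, f a ≠ a) {s : Finset α} (hs : ∀ a ∈ s, f a ∈ s) : Even s.card := by
  have h : ∑ _a ∈ s, (1 : ZMod 2) = 0 :=
    Finset.sum_involution (fun a _ => f a) (fun _ _ => by decide) (fun a _ _ => hne a)
      (fun a ha => hs a ha) fun a _ => hf a
  rw [Finset.sum_const, nsmul_one] at h
  exact (ZMod.natCast_eq_zero_iff_even).mp h

lemma not_exists_matching_gadgets :
    ¬ ∃ f : Fin 16 → Fin 16, Function.Involutive f ∧ ∀ v, gadgets.Adj v (f v) := by
  rintro ⟨f, hf, hadj⟩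
  have key : ∀ r : ℕ, r < 3 → (f 15 : ℕ) / 5 ≠ r →
      Even (Finset.univ.filter fun v : Fin 16 => (v : ℕ) / 5 = r).card := by
    intro r hr h15
    refine even_card_of_involutive hf (fun a => (hadj a).ne') fun v hv => ?_
    rw [Finset.mem_filter] at hv ⊢
    refine ⟨Finset.mem_univ _, ?_⟩
    have h : ∀ v u : Fin 16, gadgets.Adj v u → v = 15 ∨ (u : ℕ) / 5 = (v : ℕ) / 5 ∨ u = 15 := by
      decide
    rcases h v (f v) (hadj v) with h | h | h
    · rw [h] at hv
      have := hv.2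
      change 3 = r at this
      omega
    · exact h.trans hv.2
    · have hfv : f 15 = v := by rw [← h, hf v]
      rw [hfv] at h15
      exact absurd hv.2 h15
  by_cases h : (f 15 : ℕ) / 5 = 0
  · exact absurd (key 1 (by omega) (by omega)) (by decide)
  · exact absurd (key 0 (by omega) h) (by decide)

lemma not_vV1_symmetryBreaking : ¬ VV1 symmetryBreaking := by
  rintro ⟨A, T, hT⟩
  have hG : ∀ v, deg gadgets v ≤ 3 := fun v => (deg_gadgets v).le
  obtain ⟨S, hS, hu⟩ := hT 3 16 gadgets hG gadgetsPorts
  refine hS deg_gadgets not_exists_matching_gadgets ⟨S 0, fun v => ?_⟩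
  have h := exec_eq_of_regular (A 3) hG gadgetsPorts deg_gadgets gadgetsPorts_symm (T 3) v 0
  rw [hu, hu, Sum.inl.injEq] at h
  exact h

end SymmetryBreaking

end Weak

namespace Weak
/-- The linear order SB(1) ⊊ MB(1) = VB(1) ⊊ SV(1) = MV(1) = VV(1) ⊊ VVc(1). -/
theorem linear_order_constant_time :
    (∀ (Y : Type) [Fintype Y] (P : GraphProblem Y), SB1 P → MB1 P) ∧
    (∃ (Y : Type) (_ : Fintype Y) (P : GraphProblem Y), MB1 P ∧ ¬ SB1 P) ∧
    (∀ (Y : Type) [Fintype Y] (P : GraphProblem Y), MB1 P ↔ VB1 P) ∧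
    (∀ (Y : Type) [Fintype Y] (P : GraphProblem Y), VB1 P → SV1 P) ∧
    (∃ (Y : Type) (_ : Fintype Y) (P : GraphProblem Y), SV1 P ∧ ¬ VB1 P) ∧
    (∀ (Y : Type) [Fintype Y] (P : GraphProblem Y), (SV1 P ↔ MV1 P) ∧ (MV1 P ↔ VV1 P)) ∧
    (∀ (Y : Type) [Fintype Y] (P : GraphProblem Y), VV1 P → VVc1 P) ∧
    (∃ (Y : Type) (_ : Fintype Y) (P : GraphProblem Y), VVc1 P ∧ ¬ VV1 P) := by
  refine ⟨fun _ _ _ => SB1.mB1,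
    ⟨Bool, inferInstance, uniqueLeaf, mB1_uniqueLeaf, not_sB1_uniqueLeaf⟩,
    fun _ _ _ => ⟨MB1.vB1, VB1.mB1⟩, fun _ _ _ h => h.vV1.mV1.sV1,
    ⟨Bool, inferInstance, starLeader, sV1_starLeader, not_vB1_starLeader⟩,
    fun _ _ _ => ⟨⟨SV1.mV1, MV1.sV1⟩, ⟨MV1.vV1, VV1.mV1⟩⟩, fun _ _ _ => VV1.vVc1,
    ⟨Fin 3 → Fin 3, inferInstance, symmetryBreaking, vVc1_symmetryBreaking,
      not_vV1_symmetryBreaking⟩⟩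
end Weak
end

section
/- If G is a regular graph (every node has the same degree k), then there is a port numbering p of G such that all nodes of G are bisimilar in the Kripke model K_{+,+}(G,p). -/
namespace Weak

/-- A Kripke model with accessibility relations indexed by I and propositions Φ. -/
structure KripkeModel (I : Type) (Φ : Type) where
  W : Type
  R : I → W → W → Prop
  val : Φ → W → Prop

/-- Bisimulation between two Kripke models. -/
def IsBisimulation {I Φ : Type} (K K' : KripkeModel I Φ) (Z : K.W → K'.W → Prop) : Prop :=
  (∃ v v', Z v v') ∧
  (∀ v v', Z v v' → ∀ q, (K.val q v ↔ K'.val q v')) ∧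
  (∀ (α : I) (v w) (v'), Z v v' → K.R α v w → ∃ w', K'.R α v' w' ∧ Z w w') ∧
  (∀ (α : I) (v v' w'), Z v v' → K'.R α v' w' → ∃ w, K.R α v w ∧ Z w w')

/-- Two states are bisimilar if some bisimulation relates them. -/
def Bisimilar {I Φ : Type} (K K' : KripkeModel I Φ) (v : K.W) (v' : K'.W) : Prop :=
  ∃ Z, IsBisimulation K K' Z ∧ Z v v'

/-- The Kripke model K_{+,+}(G,p): relations R_{(i,j)}, valuation by degree. -/
def KPP {n : ℕ} (Δ : ℕ) (G : SimpleGraph (Fin n)) (pn : PortNumbering G) :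
    KripkeModel (Fin Δ × Fin Δ) (Fin Δ) where
  W := Fin n
  R := fun α u v => ∃ hj : (α.2 : ℕ) < deg G v,
        (pn.p ⟨v, ⟨(α.2 : ℕ), hj⟩⟩).1 = u ∧
        ((pn.p ⟨v, ⟨(α.2 : ℕ), hj⟩⟩).2 : ℕ) = (α.1 : ℕ)
  val := fun q v => deg G v = (q : ℕ) + 1

/-- The Kripke model K_{−,+}(G,p): relations R_{(*,j)}. -/
def KMP {n : ℕ} (Δ : ℕ) (G : SimpleGraph (Fin n)) (pn : PortNumbering G) :
    KripkeModel (Fin Δ) (Fin Δ) where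
  W := Fin n
  R := fun j u v => ∃ hj : (j : ℕ) < deg G v, (pn.p ⟨v, ⟨(j : ℕ), hj⟩⟩).1 = u
  val := fun q v => deg G v = (q : ℕ) + 1

/-- The Kripke model K_{+,−}(G,p): relations R_{(i,*)}. -/
def KPM {n : ℕ} (Δ : ℕ) (G : SimpleGraph (Fin n)) (pn : PortNumbering G) :
    KripkeModel (Fin Δ) (Fin Δ) where
  W := Fin n
  R := fun i u v => ∃ j : Fin (deg G v),
        (pn.p ⟨v, j⟩).1 = u ∧ ((pn.p ⟨v, j⟩).2 : ℕ) = (i : ℕ)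
  val := fun q v => deg G v = (q : ℕ) + 1

/-- The Kripke model K_{−,−}(G,p): the single relation R_{(*,*)}. -/
def KMM {n : ℕ} (Δ : ℕ) (G : SimpleGraph (Fin n)) (pn : PortNumbering G) :
    KripkeModel Unit (Fin Δ) where
  W := Fin n
  R := fun _ u v => ∃ j : Fin (deg G v), (pn.p ⟨v, j⟩).1 = u
  val := fun q v => deg G v = (q : ℕ) + 1

/-- Formulas of multimodal logic MML(I,Φ); with I = Unit this is basic modal logic ML(Φ). -/
inductive MFormula (I : Type) (Φ : Type) : Type
  | prop : Φ → MFormula I Φ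
  | and : MFormula I Φ → MFormula I Φ → MFormula I Φ
  | not : MFormula I Φ → MFormula I Φ
  | dia : I → MFormula I Φ → MFormula I Φ

/-- Truth of an MML formula at a state of a Kripke model. -/
def MSat {I Φ : Type} (K : KripkeModel I Φ) : MFormula I Φ → K.W → Prop
  | MFormula.prop q, v => K.val q v
  | MFormula.and φ ψ, v => MSat K φ v ∧ MSat K ψ v
  | MFormula.not φ, v => ¬ MSat K φ v
  | MFormula.dia α φ, v => ∃ w, K.R α v w ∧ MSat K φ w

/-- Formulas of graded multimodal logic GMML(I,Φ); with I = Unit this is GML(Φ). -/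
inductive GFormula (I : Type) (Φ : Type) : Type
  | prop : Φ → GFormula I Φ
  | and : GFormula I Φ → GFormula I Φ → GFormula I Φ
  | not : GFormula I Φ → GFormula I Φ
  | dia : I → GFormula I Φ → GFormula I Φ
  | gdia : I → ℕ → GFormula I Φ → GFormula I Φ

/-- Truth of a GMML formula at a state of a Kripke model. -/
def GSat {I Φ : Type} (K : KripkeModel I Φ) : GFormula I Φ → K.W → Prop
  | GFormula.prop q, v => K.val q v
  | GFormula.and φ ψ, v => GSat K φ v ∧ GSat K ψ v
  | GFormula.not φ, v => ¬ GSat K φ v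
  | GFormula.dia α φ, v => ∃ w, K.R α v w ∧ GSat K φ w
  | GFormula.gdia α k φ, v => k ≤ Nat.card {w : K.W // K.R α v w ∧ GSat K φ w}

end Weak
namespace Weak

open Finset in
/-- A relation on a finite type whose rows and columns all have `k + 1` elements contains the
graph of a permutation. -/
theorem exists_perm_of_biregular {V : Type*} [Fintype V] [DecidableEq V] (k : ℕ)
    (r : V → V → Prop) [DecidableRel r] (hrow : ∀ u, #{v | r u v} = k + 1)
    (hcol : ∀ v, #{u | r u v} = k + 1) : ∃ τ : Equiv.Perm V, ∀ u, r u (τ u) := by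
  have hall : ∀ A : Finset V, #A ≤ #{b | ∃ a ∈ A, r a b} := by
    intro A
    refine Nat.le_of_mul_le_mul_right (c := k + 1) ?_ k.succ_pos
    refine card_mul_le_card_mul r (fun a ha => ?_) (fun b _ => ?_)
    · rw [← hrow a]
      refine card_le_card fun v hv => ?_
      simp only [mem_filter, mem_univ, true_and, mem_bipartiteAbove] at hv ⊢
      exact ⟨⟨a, ha, hv⟩, hv⟩
    · rw [← hcol b]
      exact card_le_card (filter_subset_filter _ (subset_univ A))
  obtain ⟨f, hf, hrf⟩ := (Fintype.all_card_le_filter_rel_iff_exists_injective r).1 hall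
  exact ⟨Equiv.ofBijective f (Finite.injective_iff_bijective.1 hf), hrf⟩

open Finset in
/-- A relation on a finite type whose rows and columns all have `k` elements is the union of the
graphs of `k` permutations. -/
theorem exists_perms_of_biregular {V : Type*} [Fintype V] [DecidableEq V] (k : ℕ)
    (r : V → V → Prop) [DecidableRel r] (hrow : ∀ u, #{v | r u v} = k)
    (hcol : ∀ v, #{u | r u v} = k) :
    ∃ σ : Fin k → Equiv.Perm V, ∀ u v, (∃ i, σ i u = v) ↔ r u v := by
  induction k generalizing r with
  | zero =>
    refine ⟨fun i => i.elim0, fun u v => ⟨fun ⟨i, _⟩ => i.elim0, fun h => ?_⟩⟩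
    have := hrow u
    rw [card_eq_zero, filter_eq_empty_iff] at this
    exact absurd h (this (mem_univ v))
  | succ k ih =>
    obtain ⟨τ, hτ⟩ := exists_perm_of_biregular k r hrow hcol
    obtain ⟨σ, hσ⟩ := ih (fun u v => r u v ∧ τ u ≠ v)
      (fun u => by
        have : ({v | r u v ∧ τ u ≠ v} : Finset V) = ({v | r u v} : Finset V).erase (τ u) := by
          ext v
          simp [and_comm, eq_comm]
        rw [this, card_erase_of_mem (by simpa using hτ u), hrow, Nat.add_sub_cancel])
      (fun v => by
        have : ({u | r u v ∧ τ u ≠ v} : Finset V) =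
            ({u | r u v} : Finset V).erase (τ.symm v) := by
          ext u
          simp [and_comm, Equiv.eq_symm_apply]
        rw [this, card_erase_of_mem (by simpa using hτ (τ.symm v)), hcol, Nat.add_sub_cancel])
    refine ⟨Fin.cons τ σ, fun u v => ?_⟩
    rw [Fin.exists_fin_succ]
    simp only [Fin.cons_zero, Fin.cons_succ, hσ]
    constructor
    · rintro (rfl | h)
      exacts [hτ u, h.1]
    · intro h
      by_cases huv : τ u = v
      exacts [Or.inl huv, Or.inr ⟨h, huv⟩]

/-- In a `k`-regular graph, ports are pairs of a vertex and an element of `Fin k`. -/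
noncomputable def portEquiv {n k : ℕ} {G : SimpleGraph (Fin n)} (hreg : ∀ v, deg G v = k) :
    Port G ≃ Fin n × Fin k :=
  (Equiv.sigmaCongrRight fun v => finCongr (hreg v)).trans (Equiv.sigmaEquivProd _ _)

/-- The port numbering of a `k`-regular graph sending port `i` of `v` to port `i` of `σ i v`. -/
noncomputable def PortNumbering.ofPerms {n k : ℕ} {G : SimpleGraph (Fin n)} (hreg : ∀ v, deg G v = k)
    (σ : Fin k → Equiv.Perm (Fin n)) (hσ : ∀ u v, (∃ i, σ i u = v) ↔ G.Adj u v) :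
    PortNumbering G where
  p := ((portEquiv hreg).trans
    { toFun := fun x => (σ x.2 x.1, x.2)
      invFun := fun x => ((σ x.2).symm x.1, x.2)
      left_inv := fun x => by simp
      right_inv := fun x => by simp }).trans (portEquiv hreg).symm
  adj u v := by
    rw [← hσ]
    exact (finCongr (hreg u)).exists_congr fun _ => Iff.rfl

/-- In the Kripke model of `PortNumbering.ofPerms`, the relation `(i, j)` is empty unless `i = j`,
and then it is the inverse of the graph of `σ j`. -/
theorem KPP_ofPerms_rel_iff {n k : ℕ} {G : SimpleGraph (Fin n)} (hreg : ∀ v, deg G v = k)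
    (σ : Fin k → Equiv.Perm (Fin n)) (hσ : ∀ u v, (∃ i, σ i u = v) ↔ G.Adj u v)
    (α : Fin k × Fin k) (u v : Fin n) :
    (KPP k G (.ofPerms hreg σ hσ)).R α u v ↔ σ α.2 v = u ∧ α.2 = α.1 := by
  have hval : ∀ q : Port G, (((PortNumbering.ofPerms hreg σ hσ).p q).2 : ℕ) = q.2 := fun q => rfl
  have hfst : ∀ q : Port G, ((PortNumbering.ofPerms hreg σ hσ).p q).1 =
      σ (Fin.cast (hreg q.1) q.2) q.1 := fun q => rfl
  simp [KPP, hval, hfst, hreg, Fin.ext_iff]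

/-- Lemma: every regular graph has a port numbering making all nodes bisimilar
in K_{+,+}(G,p). -/
theorem regular_all_bisimilar {n : ℕ} (k : ℕ) (G : SimpleGraph (Fin n))
    (hreg : ∀ v, deg G v = k) :
    ∃ pn : PortNumbering G,
      ∀ u v : Fin n, Bisimilar (KPP k G pn) (KPP k G pn) u v := by
  classical
  have hrow (u : Fin n) : (Finset.univ.filter fun v => G.Adj u v).card = k := by
    rw [← hreg u, deg, Nat.card_eq_fintype_card, Fintype.card_subtype]
  have hcol (v : Fin n) : (Finset.univ.filter fun u => G.Adj u v).card = k := by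
    simpa only [G.adj_comm] using hrow v
  obtain ⟨σ, hσ⟩ := exists_perms_of_biregular k G.Adj hrow hcol
  have step (α : Fin k × Fin k) (v w v' : Fin n)
      (h : (KPP k G (.ofPerms hreg σ hσ)).R α v w) :
      ∃ w', (KPP k G (.ofPerms hreg σ hσ)).R α v' w' := by
    rw [KPP_ofPerms_rel_iff] at h
    exact ⟨(σ α.2).symm v', (KPP_ofPerms_rel_iff ..).2 ⟨(σ α.2).apply_symm_apply v', h.2⟩⟩
  refine ⟨.ofPerms hreg σ hσ, fun u v => ⟨fun _ _ => True, ⟨⟨u, v, trivial⟩, ?_, ?_, ?_⟩, trivial⟩⟩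
  · intro v v' _ q
    simp only [KPP, hreg v, hreg v']
  · intro α v w v' _ h
    exact (step α v w v' h).imp fun _ h => ⟨h, trivial⟩
  · intro α v v' w' _ h
    exact (step α v' w' v h).imp fun _ h => ⟨h, trivial⟩
end Weak
end
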